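/- arXiv:1308.0187 — 4 statements merged into one kernel-verified Lean document; each statement's English description precedes it below -/
import Mathlib

section
/- Let X be a finite set, let x ∈ X, and let Φ be a potential on X. Define Φ₊ to be the potential on X \ {x} given by Φ₊(Z) = Φ(Z ∪ {x}) for every Z ⊆ X \ {x}. Then for every Y ⊆ X \ {x}, the p-dual of Φ₊ satisfies (Φ₊)*(Y) = Φ*(Y) / Φ*(Y ∪ {x}). -/
open Finset

/-- The p-dual of a potential `Φ`: `Φ*(Y) = ∏_{Z ⊆ Y} Φ(Z)^((-1)^|Z|)`. -/
noncomputable def pdual {α : Type*} [DecidableEq α] (Φ : Finset α → ℝ) (Y : Finset α) : ℝ :=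
  ∏ Z ∈ Y.powerset, Φ Z ^ ((-1 : ℤ) ^ Z.card)

/-- if `Φ₊(Z) = Φ(Z ∪ {x})` for `Z ⊆ X \ {x}`, then for every
`Y ⊆ X \ {x}` we have `(Φ₊)*(Y) = Φ*(Y) / Φ*(Y ∪ {x})`. -/
theorem pdual_plus {α : Type*} [DecidableEq α] (X : Finset α) (x : α) (hx : x ∈ X)
    (Φ : Finset α → ℝ) (hΦ : ∀ Z ⊆ X, 0 < Φ Z)
    (Φp : Finset α → ℝ) (hΦp : ∀ Z ⊆ X \ {x}, Φp Z = Φ (Z ∪ {x}))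
    (Y : Finset α) (hY : Y ⊆ X \ {x}) :
    pdual Φp Y = pdual Φ Y / pdual Φ (Y ∪ {x}) := by
  have hxY : x ∉ Y := fun h => by simpa using hY h
  have hYX : Y ⊆ X := hY.trans sdiff_subset
  have hpos : pdual Φ Y ≠ 0 :=
    prod_ne_zero_iff.mpr fun Z hZ =>
      zpow_ne_zero _ (hΦ Z ((mem_powerset.mp hZ).trans hYX)).ne'
  have key : pdual Φ (Y ∪ {x}) = pdual Φ Y * (pdual Φp Y)⁻¹ := by
    rw [union_singleton]
    unfold pdual
    rw [prod_powerset_insert hxY, ← prod_inv_distrib]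
    congr 1
    refine prod_congr rfl fun Z hZ => ?_
    have hZY := mem_powerset.mp hZ
    rw [hΦp Z (hZY.trans hY), union_singleton, card_insert_of_notMem fun h => hxY (hZY h),
      pow_succ, mul_neg_one, zpow_neg]
  rw [key, div_mul_eq_div_div, div_self hpos, one_div, inv_inv]
end

section
/- Let X be a finite set, let Y ⊆ X, and let Φ be a potential on Y. Define Φ' to be the potential on X given by Φ'(Z) = Φ(Z ∩ Y) for every Z ⊆ X. Then for every U ⊆ X with U ⊄ Y (i.e. U is not a subset of Y), the p-dual of Φ' satisfies (Φ')*(U) = 1. -/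
open Finset

/-- if `Φ` is a potential on `Y ⊆ X` and `Φ'(Z) = Φ(Z ∩ Y)` for
`Z ⊆ X`, then for `U ⊆ X` with `U ⊄ Y` we have `(Φ')*(U) = 1`. -/
theorem pdual_extend_not_subset {α : Type*} [DecidableEq α] (X Y : Finset α) (hYX : Y ⊆ X)
    (Φ : Finset α → ℝ) (hΦ : ∀ Z ⊆ Y, 0 < Φ Z)
    (Φ' : Finset α → ℝ) (hΦ' : ∀ Z ⊆ X, Φ' Z = Φ (Z ∩ Y))
    (U : Finset α) (hUX : U ⊆ X) (hUY : ¬ U ⊆ Y) :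
    pdual Φ' U = 1 := by
  obtain ⟨u, huU, huY⟩ := not_subset.mp hUY
  rw [pdual, ← insert_erase huU, prod_powerset_insert (notMem_erase u U), ← prod_mul_distrib]
  refine prod_eq_one fun Z hZ => ?_
  have hZU : Z ⊆ U.erase u := mem_powerset.mp hZ
  have huZ : u ∉ Z := fun h => notMem_erase u U (hZU h)
  have hZX : Z ⊆ X := (hZU.trans (erase_subset u U)).trans hUX
  rw [hΦ' Z hZX, hΦ' _ (insert_subset (hUX huU) hZX), insert_inter_of_notMem huY,
    card_insert_of_notMem huZ, ← zpow_add₀ (hΦ _ inter_subset_right).ne', pow_succ,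
    mul_neg_one, add_neg_cancel, zpow_zero]
end

section
/- Let X be a finite set, let Y₁, …, Y_k be subsets of X with Y₁ ∪ ⋯ ∪ Y_k = X, and for each i ∈ {1, …, k} let Φᵢ be a potential on Yᵢ. Let ∏ᵢ Φᵢ denote the product potential on X, defined by (∏ᵢ Φᵢ)(Z) = ∏_{i=1}^{k} Φᵢ(Z ∩ Yᵢ) for every Z ⊆ X. Then for every U ⊆ X, the p-dual of the product satisfies (∏ᵢ Φᵢ)*(U) = ∏_{i : U ⊆ Yᵢ} (Φᵢ)*(U), where the product on the right is over all indices i with U ⊆ Yᵢ. -/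
open Finset

theorem pdual_finset_prod {α ι : Type*} [DecidableEq α] (s : Finset ι)
    (F : ι → Finset α → ℝ) (U : Finset α) :
    pdual (fun Z => ∏ i ∈ s, F i Z) U = ∏ i ∈ s, pdual (F i) U := by
  simp only [pdual, ← Finset.prod_zpow]
  exact Finset.prod_comm

theorem pdual_inter_of_subset {α : Type*} [DecidableEq α] (Φ : Finset α → ℝ)
    {U Y : Finset α} (h : U ⊆ Y) : pdual (fun Z => Φ (Z ∩ Y)) U = pdual Φ U := by
  refine Finset.prod_congr rfl fun Z hZ => ?_
  beta_reduce
  rw [Finset.inter_eq_left.2 ((Finset.mem_powerset.1 hZ).trans h)]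

/-- If `U` has a point `a` outside `Y`, the factors at `Z` and `insert a Z` cancel. -/
theorem pdual_inter_of_not_subset {α : Type*} [DecidableEq α] {Φ : Finset α → ℝ}
    {U Y : Finset α} (hΦ : ∀ Z ⊆ Y, Φ Z ≠ 0) (h : ¬ U ⊆ Y) :
    pdual (fun Z => Φ (Z ∩ Y)) U = 1 := by
  obtain ⟨a, haU, haY⟩ := Finset.not_subset.1 h
  rw [pdual, ← Finset.insert_erase haU,
    Finset.prod_powerset_insert (Finset.notMem_erase a U), ← Finset.prod_mul_distrib]
  refine Finset.prod_eq_one fun Z hZ => ?_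
  have haZ : a ∉ Z := fun ha => Finset.notMem_erase a U (Finset.mem_powerset.1 hZ ha)
  rw [Finset.insert_inter_of_notMem haY, Finset.card_insert_of_notMem haZ,
    ← zpow_add₀ (hΦ _ Finset.inter_subset_right), pow_succ, mul_neg_one, add_neg_cancel,
    zpow_zero]

/-- for potentials `Φᵢ` on `Yᵢ` with `⋃ᵢ Yᵢ = X`, the p-dual of the
product potential `Z ↦ ∏ᵢ Φᵢ(Z ∩ Yᵢ)` at `U ⊆ X` equals `∏_{i : U ⊆ Yᵢ} (Φᵢ)*(U)`. -/
theorem pdual_prod {α : Type*} [DecidableEq α] (X : Finset α) (k : ℕ)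
    (Y : Fin k → Finset α) (hcover : Finset.univ.biUnion Y = X)
    (Φ : Fin k → Finset α → ℝ) (hΦ : ∀ i, ∀ Z ⊆ Y i, 0 < Φ i Z)
    (U : Finset α) (hU : U ⊆ X) :
    pdual (fun Z => ∏ i, Φ i (Z ∩ Y i)) U
      = ∏ i ∈ Finset.univ.filter (fun i => U ⊆ Y i), pdual (Φ i) U := by
  rw [pdual_finset_prod, Finset.prod_filter]
  refine Finset.prod_congr rfl fun i _ => ?_
  split_ifs with h
  · exact pdual_inter_of_subset (Φ i) h
  · exact pdual_inter_of_not_subset (fun Z hZ => (hΦ i Z hZ).ne') h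
end

section
/- Let X be a finite set, let D₁, …, D_k be subsets of X with D₁ ∪ ⋯ ∪ D_k = X, and for each i ∈ {1, …, k} let Υᵢ be a potential on Dᵢ. Let Γ denote the product potential on X, Γ(Z) = ∏_{i=1}^{k} Υᵢ(Z ∩ Dᵢ). Then for every Z ⊆ X such that Z is not a subset of any Dᵢ, the p-dual of Γ satisfies Γ*(Z) = 1. -/
open Finset

/-- If `x ∈ Y` and `Φ` does not see the element `x`, then the factors of `pdual Φ Y` cancel in
pairs `Z`, `insert x Z`. -/
theorem pdual_eq_one_of_insert_eq {α : Type*} [DecidableEq α] {Φ : Finset α → ℝ} {Y : Finset α}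
    {x : α} (hx : x ∈ Y) (hΦ : ∀ Z ⊆ Y, Φ Z ≠ 0) (hins : ∀ Z ⊆ Y, Φ (insert x Z) = Φ Z) :
    pdual Φ Y = 1 := by
  rw [pdual, ← insert_erase hx, prod_powerset_insert (notMem_erase x Y), ← prod_mul_distrib]
  refine prod_eq_one fun Z hZ => ?_
  have hZ' : Z ⊆ Y.erase x := mem_powerset.1 hZ
  have hxZ : x ∉ Z := fun h => notMem_erase x Y (hZ' h)
  have hZY : Z ⊆ Y := hZ'.trans (erase_subset x Y)
  rw [hins Z hZY, card_insert_of_notMem hxZ, ← zpow_add₀ (hΦ Z hZY), pow_succ]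
  simp

/-- The p-dual is multiplicative. -/
theorem pdual_prod_s7 {α ι : Type*} [DecidableEq α] (s : Finset ι) (Φ : ι → Finset α → ℝ)
    (Y : Finset α) : pdual (fun W => ∏ i ∈ s, Φ i W) Y = ∏ i ∈ s, pdual (Φ i) Y := by
  simp only [pdual, ← prod_zpow]
  exact prod_comm

/-- for potentials `Υᵢ` on `Dᵢ` with `⋃ᵢ Dᵢ = X`, the p-dual of the
product potential `Γ(Z) = ∏ᵢ Υᵢ(Z ∩ Dᵢ)` equals `1` at every `Z ⊆ X` that is
not a subset of any `Dᵢ`. -/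
theorem pdual_prod_eq_one {α : Type*} [DecidableEq α] (X : Finset α) (k : ℕ)
    (D : Fin k → Finset α) (hcover : Finset.univ.biUnion D = X)
    (Υ : Fin k → Finset α → ℝ) (hΥ : ∀ i, ∀ Z ⊆ D i, 0 < Υ i Z)
    (Z : Finset α) (hZ : Z ⊆ X) (hnot : ∀ i, ¬ Z ⊆ D i) :
    pdual (fun W => ∏ i, Υ i (W ∩ D i)) Z = 1 := by
  rw [pdual_prod_s7]
  refine prod_eq_one fun i _ => ?_
  obtain ⟨x, hxZ, hxD⟩ := not_subset.1 (hnot i)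
  refine pdual_eq_one_of_insert_eq hxZ (fun W _ => (hΥ i _ inter_subset_right).ne')
    fun W _ => ?_
  rw [insert_inter_of_notMem hxD]
end
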